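/- For integers k ≥ 1 and s with Re(s) ≥ 1, ∫_{-∞}^{∞} (u - i) / ((u + i)^{k+1} (u² + 1)^s) du = (π · 2^{2-k-2s} Γ(2s+k-1)) / (Γ(s+k+1) Γ(s-1)) · i^{-(k+2)}. -/

import Mathlib

open Complex

noncomputable def cbW (s : ℂ) (u : ℝ) : ℂ := ((u : ℂ) ^ 2 + 1) ^ (-s)
noncomputable def cbF (s : ℂ) (j : ℕ) (u : ℝ) : ℂ :=
  (1 + u * I) / (1 - u * I) ^ (j + 1) * cbW s u

theorem cb_cast (u : ℝ) : (u : ℂ) ^ 2 + 1 = ((u ^ 2 + 1 : ℝ) : ℂ) := by push_cast; ring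

theorem cb_prod (u : ℝ) : (u : ℂ) ^ 2 + 1 = (1 + u * I) * (1 - u * I) := by
  ring_nf; simp

theorem cb_ne (u : ℝ) : (u : ℂ) ^ 2 + 1 ≠ 0 := by
  rw [cb_cast]; exact_mod_cast (by positivity : (u ^ 2 + 1 : ℝ) ≠ 0)

theorem cb_ne1 (u : ℝ) : (1 + u * I : ℂ) ≠ 0 := by
  have := cb_ne u; rw [cb_prod] at this; exact left_ne_zero_of_mul this

theorem cb_ne2 (u : ℝ) : (1 - u * I : ℂ) ≠ 0 := by
  have := cb_ne u; rw [cb_prod] at this; exact right_ne_zero_of_mul this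

theorem cb_norm1 (u : ℝ) : ‖(1 + u * I : ℂ)‖ = √(u ^ 2 + 1) := by
  have := Complex.norm_add_mul_I 1 u
  simp only [ofReal_one] at this
  rw [this]; ring_nf

theorem cb_norm2 (u : ℝ) : ‖(1 - u * I : ℂ)‖ = √(u ^ 2 + 1) := by
  have := cb_norm1 (-u)
  rw [show (1 + ((-u : ℝ) : ℂ) * I) = 1 - u * I by push_cast; ring] at this
  rw [this]; ring_nf

theorem cb_normW (s : ℂ) (hs : 1 ≤ s.re) (u : ℝ) : ‖cbW s u‖ ≤ (1 + u ^ 2)⁻¹ := by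
  rw [cbW, cb_cast, Complex.norm_cpow_eq_rpow_re_of_pos (by positivity), add_comm 1,
    ← Real.rpow_neg_one]
  apply Real.rpow_le_rpow_of_exponent_le
  · nlinarith [sq_nonneg u]
  · simpa using hs

theorem cb_contW (s : ℂ) : Continuous (cbW s) := by
  unfold cbW
  refine Continuous.cpow (by fun_prop) continuous_const fun u => ?_
  rw [cb_cast, ofReal_mem_slitPlane]; positivity

theorem cb_intW (s : ℂ) (hs : 1 ≤ s.re) : MeasureTheory.Integrable (cbW s) :=
  integrable_inv_one_add_sq.mono' (cb_contW s).aestronglyMeasurable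
    (Filter.Eventually.of_forall (cb_normW s hs))

theorem cb_sqrt (u : ℝ) : 1 ≤ √(u ^ 2 + 1) := by
  rw [Real.one_le_sqrt]; nlinarith [sq_nonneg u]

theorem cb_intF (s : ℂ) (hs : 1 ≤ s.re) (j : ℕ) : MeasureTheory.Integrable (cbF s j) := by
  refine integrable_inv_one_add_sq.mono' (Continuous.aestronglyMeasurable ?_)
    (Filter.Eventually.of_forall fun u => ?_)
  · unfold cbF
    refine Continuous.mul (Continuous.div (by fun_prop) (by fun_prop)
      fun u => pow_ne_zero _ (cb_ne2 u)) (cb_contW s)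
  · unfold cbF
    rw [norm_mul, norm_div, norm_pow, cb_norm1, cb_norm2]
    refine le_trans (mul_le_of_le_one_left (norm_nonneg _) ?_) (cb_normW s hs u)
    have h := cb_sqrt u
    rw [div_le_one (by positivity)]
    exact le_self_pow₀ h (by omega)

theorem cb_tendsto (G : ℝ → ℂ) (h : ∀ u, ‖G u‖ ≤ (√(u ^ 2 + 1))⁻¹) :
    Filter.Tendsto G Filter.atTop (nhds 0) ∧ Filter.Tendsto G Filter.atBot (nhds 0) := by
  have h2 : ∀ u, ‖G u‖ ≤ |u|⁻¹ ∨ u = 0 := by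
    intro u
    by_cases hu : u = 0
    · exact Or.inr hu
    · left
      refine (h u).trans (inv_anti₀ (abs_pos.mpr hu) (Real.abs_le_sqrt (by linarith)))
  constructor
  · refine squeeze_zero_norm' (a := fun u => |u|⁻¹) ?_
      (Filter.tendsto_abs_atTop_atTop.inv_tendsto_atTop)
    filter_upwards [Filter.eventually_ne_atTop 0] with u hu
    exact (h2 u).resolve_right hu
  · refine squeeze_zero_norm' (a := fun u => |u|⁻¹) ?_
      (Filter.tendsto_abs_atBot_atTop.inv_tendsto_atTop)
    filter_upwards [Filter.eventually_ne_atBot 0] with u hu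
    exact (h2 u).resolve_right hu

theorem cb_derivW (s : ℂ) (u : ℝ) :
    HasDerivAt (cbW s) (I * s * ((1 + u * I) - (1 - u * I)) / ((1 + u * I) * (1 - u * I)) * cbW s u) u := by
  have h0 : HasDerivAt (fun z : ℂ => z ^ 2 + 1) (2 * (u : ℂ)) (u : ℂ) := by
    simpa using (hasDerivAt_pow 2 (u : ℂ)).add_const 1
  have h := (h0.cpow_const (c := -s)
    (by rw [cb_cast, ofReal_mem_slitPlane]; positivity)).comp_ofReal
  refine h.congr_deriv ?_
  have e : I * s * ((1 + u * I) - (1 - u * I)) = -(2 * s * u) := by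
    linear_combination 2 * s * u * I_mul_I
  rw [e, cbW, cpow_sub _ _ (cb_ne u), cpow_one, ← cb_prod]
  have := cb_ne u
  field_simp

theorem cb_base (s : ℂ) (hs : 1 ≤ s.re) :
    s * ∫ u, cbF s 0 u = (s - 1) * ∫ u, cbW s u := by
  have hd : ∀ u : ℝ, HasDerivAt (fun u : ℝ => (1 + u * I) * cbW s u)
      (I * (s * cbF s 0 u - (s - 1) * cbW s u)) u := by
    intro u
    have h1 : HasDerivAt (fun u : ℝ => (1 + u * I : ℂ)) I u := by
      simpa using ((hasDerivAt_id u).ofReal_comp.mul_const I).const_add 1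
    refine (h1.mul (cb_derivW s u)).congr_deriv ?_
    have a := cb_ne1 u
    have b := cb_ne2 u
    simp only [cbF]
    generalize cbW s u = w
    generalize (1 + u * I : ℂ) = A at *
    generalize (1 - u * I : ℂ) = B at *
    field_simp
    ring
  have hT := cb_tendsto (fun u : ℝ => (1 + u * I) * cbW s u) (by
    intro u
    rw [norm_mul, cb_norm1]
    have h := cb_normW s hs u
    have h2 := cb_sqrt u
    calc _ ≤ √(u ^ 2 + 1) * (1 + u ^ 2)⁻¹ := by gcongr
      _ = _ := by
        rw [show 1 + u ^ 2 = √(u ^ 2 + 1) * √(u ^ 2 + 1) by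
          rw [Real.mul_self_sqrt (by positivity)]; ring]
        field_simp)
  have i1 := (cb_intF s hs 0).const_mul s
  have i2 := (cb_intW s hs).const_mul (s - 1)
  have := MeasureTheory.integral_of_hasDerivAt_of_tendsto hd ((i1.sub i2).const_mul I) hT.2 hT.1
  rw [MeasureTheory.integral_const_mul, MeasureTheory.integral_sub i1 i2,
    MeasureTheory.integral_const_mul, MeasureTheory.integral_const_mul] at this
  simpa [sub_eq_zero] using this

theorem cb_step (s : ℂ) (hs : 1 ≤ s.re) (j : ℕ) :
    2 * (s + j + 1) * ∫ u, cbF s (j + 1) u = (2 * s + j - 1) * ∫ u, cbF s j u := by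
  have hd : ∀ u : ℝ, HasDerivAt (fun u : ℝ => (1 + u * I) ^ 2 / (1 - u * I) ^ (j + 1) * cbW s u)
      (I * (2 * (s + j + 1) * cbF s (j + 1) u - (2 * s + j - 1) * cbF s j u)) u := by
    intro u
    have h1 : HasDerivAt (fun u : ℝ => (1 + u * I : ℂ)) I u := by
      simpa using ((hasDerivAt_id u).ofReal_comp.mul_const I).const_add 1
    have h2 : HasDerivAt (fun u : ℝ => (1 - u * I : ℂ)) (-I) u := by
      simpa using ((hasDerivAt_id u).ofReal_comp.mul_const I).const_sub 1
    have a := cb_ne1 u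
    have b := cb_ne2 u
    refine (((h1.pow 2).div (h2.pow (j + 1)) (pow_ne_zero _ b)).mul (cb_derivW s u)).congr_deriv ?_
    simp only [cbF, Pi.pow_apply, Pi.div_apply]
    generalize cbW s u = w
    have hab : 2 * (s + j + 1) = ((1 + u * I) + (1 - u * I)) * (s + j + 1) := by ring
    rw [hab]
    generalize (1 + u * I : ℂ) = A at *
    generalize (1 - u * I : ℂ) = B at *
    push_cast
    try simp only [Nat.add_sub_cancel]
    field_simp
    ring
  have hT := cb_tendsto (fun u : ℝ => (1 + u * I) ^ 2 / (1 - u * I) ^ (j + 1) * cbW s u) (by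
    intro u
    rw [norm_mul, norm_div, norm_pow, norm_pow, cb_norm1, cb_norm2]
    have h := cb_normW s hs u
    have h2 := cb_sqrt u
    have h3 : √(u ^ 2 + 1) ^ 2 / √(u ^ 2 + 1) ^ (j + 1) ≤ √(u ^ 2 + 1) := by
      rw [div_le_iff₀ (by positivity), ← pow_succ']
      exact pow_le_pow_right₀ h2 (by omega)
    calc _ ≤ √(u ^ 2 + 1) * (1 + u ^ 2)⁻¹ := by gcongr
      _ = _ := by
        rw [show 1 + u ^ 2 = √(u ^ 2 + 1) * √(u ^ 2 + 1) by
          rw [Real.mul_self_sqrt (by positivity)]; ring]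
        field_simp)
  have i1 := (cb_intF s hs (j + 1)).const_mul (2 * (s + j + 1))
  have i2 := (cb_intF s hs j).const_mul (2 * s + j - 1)
  have := MeasureTheory.integral_of_hasDerivAt_of_tendsto hd ((i1.sub i2).const_mul I) hT.2 hT.1
  rw [MeasureTheory.integral_const_mul, MeasureTheory.integral_sub i1 i2,
    MeasureTheory.integral_const_mul, MeasureTheory.integral_const_mul] at this
  simpa [sub_eq_zero] using this

noncomputable def cbPhi (u : ℝ) : ℝ := (1 + u / √(u ^ 2 + 1)) / 2

theorem cb_phi_deriv (u : ℝ) :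
    HasDerivAt cbPhi ((√(u ^ 2 + 1))⁻¹ * (u ^ 2 + 1)⁻¹ / 2) u := by
  have hp : (0 : ℝ) < u ^ 2 + 1 := by positivity
  have h0 : HasDerivAt (fun z : ℝ => z ^ 2 + 1) (2 * u) u := by
    simpa using (hasDerivAt_pow 2 u).add_const 1
  have h1 := h0.sqrt hp.ne'
  have hq : 0 < √(u ^ 2 + 1) := Real.sqrt_pos.mpr hp
  refine ((((hasDerivAt_id u).div h1 hq.ne').const_add 1).div_const 2).congr_deriv ?_
  have e : u ^ 2 + 1 = √(u ^ 2 + 1) ^ 2 := (Real.sq_sqrt hp.le).symm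
  have e2 : u ^ 2 = √(u ^ 2 + 1) ^ 2 - 1 := by linarith
  rw [show (√(u ^ 2 + 1))⁻¹ * (u ^ 2 + 1)⁻¹ = (√(u ^ 2 + 1))⁻¹ * (√(u ^ 2 + 1) ^ 2)⁻¹ by rw [← e]]
  generalize √(u ^ 2 + 1) = q at *
  simp only [id]
  field_simp
  linarith

theorem cb_phi_inj : Function.Injective cbPhi :=
  (strictMono_of_deriv_pos fun u => by
    rw [(cb_phi_deriv u).deriv]; positivity).injective

theorem cb_phi_mul (u : ℝ) : cbPhi u * (1 - cbPhi u) = (4 * (u ^ 2 + 1))⁻¹ := by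
  have hp : (0 : ℝ) < u ^ 2 + 1 := by positivity
  have hq : 0 < √(u ^ 2 + 1) := Real.sqrt_pos.mpr hp
  have e : √(u ^ 2 + 1) ^ 2 = u ^ 2 + 1 := Real.sq_sqrt hp.le
  rw [← e, cbPhi]
  generalize √(u ^ 2 + 1) = q at *
  field_simp
  linarith

theorem cb_phi_mem (u : ℝ) : 0 < cbPhi u ∧ cbPhi u < 1 := by
  have hp : (0 : ℝ) < u ^ 2 + 1 := by positivity
  have h := cb_phi_mul u
  have h2 : 0 < (4 * (u ^ 2 + 1))⁻¹ := by positivity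
  rw [← h] at h2
  constructor <;> nlinarith [sq_nonneg (cbPhi u), sq_nonneg (1 - cbPhi u)]

theorem cb_phi_image : cbPhi '' Set.univ = Set.Ioo 0 1 := by
  ext x
  constructor
  · rintro ⟨u, -, rfl⟩
    exact cb_phi_mem u
  · rintro ⟨h0, h1⟩
    have hv : 0 < 1 - (2 * x - 1) ^ 2 := by nlinarith
    have hq : 0 < √(1 - (2 * x - 1) ^ 2) := Real.sqrt_pos.mpr hv
    have e := Real.sq_sqrt hv.le
    refine ⟨(2 * x - 1) / √(1 - (2 * x - 1) ^ 2), trivial, ?_⟩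
    have : ((2 * x - 1) / √(1 - (2 * x - 1) ^ 2)) ^ 2 + 1 = (√(1 - (2 * x - 1) ^ 2))⁻¹ ^ 2 := by
      generalize √(1 - (2 * x - 1) ^ 2) = q at *
      field_simp
      linarith
    rw [cbPhi, this, Real.sqrt_sq (by positivity)]
    field_simp
    ring

theorem cb_beta (s : ℂ) :
    betaIntegral (s - 1 / 2) (s - 1 / 2) = (4 : ℂ) ^ (3 / 2 - s) / 2 * ∫ u, cbW s u := by
  rw [betaIntegral, intervalIntegral.integral_of_le zero_le_one,
    MeasureTheory.integral_Ioc_eq_integral_Ioo, ← cb_phi_image,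
    MeasureTheory.integral_image_eq_integral_abs_deriv_smul MeasurableSet.univ
      (fun x _ => (cb_phi_deriv x).hasDerivWithinAt) cb_phi_inj.injOn,
    MeasureTheory.setIntegral_univ, ← MeasureTheory.integral_const_mul]
  refine MeasureTheory.integral_congr_ae (Filter.Eventually.of_forall fun u => ?_)
  have hp : (0 : ℝ) < u ^ 2 + 1 := by positivity
  obtain ⟨m0, m1⟩ := cb_phi_mem u
  have e1 : (1 - (cbPhi u : ℂ)) = ((1 - cbPhi u : ℝ) : ℂ) := by push_cast; ring
  simp only
  rw [e1, ← mul_cpow_ofReal_nonneg m0.le (by linarith), ← ofReal_mul, cb_phi_mul,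
    abs_of_pos (by positivity), real_smul, cbW, cb_cast, mul_inv, ofReal_mul,
    mul_cpow_ofReal_nonneg (by norm_num) (by positivity)]
  have f1 : (((4 : ℝ)⁻¹ : ℝ) : ℂ) ^ (s - 1 / 2 - 1) = (4 : ℂ) ^ (3 / 2 - s) := by
    rw [show (3 / 2 - s) = -(s - 1 / 2 - 1) by ring, cpow_neg, ofReal_inv, inv_cpow]
    · norm_num
    · rw [arg_ofReal_of_nonneg (by norm_num)]; exact Real.pi_pos.ne
  have f2 : (((u ^ 2 + 1)⁻¹ : ℝ) : ℂ) ^ (s - 1 / 2 - 1) =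
      ((u ^ 2 + 1 : ℝ) : ℂ) ^ (3 / 2 - s) := by
    rw [show (3 / 2 - s) = -(s - 1 / 2 - 1) by ring, cpow_neg, ofReal_inv, inv_cpow]
    rw [arg_ofReal_of_nonneg hp.le]; exact Real.pi_pos.ne
  have hne : ((u ^ 2 + 1 : ℝ) : ℂ) ≠ 0 := by exact_mod_cast hp.ne'
  have f3 : (((√(u ^ 2 + 1))⁻¹ * (u ^ 2 + 1)⁻¹ / 2 : ℝ) : ℂ) =
      ((u ^ 2 + 1 : ℝ) : ℂ) ^ (-(3 / 2) : ℂ) / 2 := by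
    have : (√(u ^ 2 + 1))⁻¹ * (u ^ 2 + 1)⁻¹ = (u ^ 2 + 1) ^ (-(3 / 2) : ℝ) := by
      rw [show (-(3 / 2) : ℝ) = -(1 / 2) + -1 by norm_num, Real.rpow_add hp, Real.rpow_neg hp.le,
        Real.rpow_neg_one, Real.sqrt_eq_rpow]
    rw [this, ofReal_div, ofReal_cpow hp.le]
    push_cast
    rfl
  rw [f1, f2, f3, show -s = -(3 / 2) + (3 / 2 - s) by ring, cpow_add _ _ hne]
  ring

theorem cb_intW_eq (s : ℂ) (hs : 1 ≤ s.re) :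
    ∫ u, cbW s u = Real.pi * 2 ^ (2 - 2 * s) * Gamma (2 * s - 1) / Gamma s ^ 2 := by
  have hp : 0 < (s - 1 / 2).re := by
    have : (s - 1 / 2).re = s.re - 1 / 2 := by simp
    linarith
  have h1 := Gamma_mul_Gamma_eq_betaIntegral hp hp
  have h2 := Gamma_mul_Gamma_add_half (s - 1 / 2)
  rw [cb_beta] at h1
  rw [show s - 1 / 2 + 1 / 2 = s by ring, show 2 * (s - 1 / 2) = 2 * s - 1 by ring,
    show 1 - (2 * s - 1) = 2 - 2 * s by ring] at h2
  rw [show s - 1 / 2 + (s - 1 / 2) = 2 * s - 1 by ring] at h1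
  have g1 : Gamma s ≠ 0 := Gamma_ne_zero_of_re_pos (by linarith)
  have g2 : Gamma (2 * s - 1) ≠ 0 := Gamma_ne_zero_of_re_pos (by
    have : (2 * s - 1).re = 2 * s.re - 1 := by simp
    linarith)
  have h4 : (4 : ℂ) ^ (3 / 2 - s) = 2 * 2 ^ (2 - 2 * s) := by
    rw [show (4 : ℂ) = ((2 : ℝ) : ℂ) * ((2 : ℝ) : ℂ) by push_cast; norm_num,
      mul_cpow_ofReal_nonneg (by norm_num) (by norm_num), ofReal_ofNat,
      ← cpow_add _ _ two_ne_zero,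
      show 3 / 2 - s + (3 / 2 - s) = 1 + (2 - 2 * s) by ring, cpow_add _ _ two_ne_zero, cpow_one]
  have t : (2 : ℂ) ^ (2 - 2 * s) ≠ 0 := by simp [cpow_eq_zero_iff]
  have hpi : ((√Real.pi : ℝ) : ℂ) ^ 2 = Real.pi := by
    rw [← ofReal_pow, Real.sq_sqrt Real.pi_pos.le]
  rw [h4] at h1
  rw [eq_div_iff (pow_ne_zero 2 g1), ← hpi]
  apply mul_left_cancel₀ (mul_ne_zero g2 t)
  generalize (∫ u, cbW s u) = J at *
  generalize ((√Real.pi : ℝ) : ℂ) = q at *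
  generalize (2 : ℂ) ^ (2 - 2 * s) = T at *
  generalize Gamma (s - 1 / 2) = a at *
  linear_combination (-Gamma s ^ 2) * h1 + (a * Gamma s + Gamma (2 * s - 1) * T * q) * h2

theorem cb_closed (s : ℂ) (hs : 1 ≤ s.re) (j : ℕ) :
    ∫ u, cbF s j u = Real.pi * 2 ^ (2 - (j : ℂ) - 2 * s) * Gamma (2 * s + j - 1) /
      (Gamma (s + j + 1) * Gamma (s - 1)) := by
  have g : (Gamma (s - 1))⁻¹ = (s - 1) * (Gamma s)⁻¹ := by
    simpa using one_div_Gamma_eq_self_mul_one_div_Gamma_add_one (s - 1)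
  have g1 : Gamma s ≠ 0 := Gamma_ne_zero_of_re_pos (by linarith)
  have s0 : s ≠ 0 := by rintro rfl; norm_num at hs
  rw [div_eq_mul_inv, mul_inv, g]
  induction j with
  | zero =>
    apply mul_left_cancel₀ s0
    rw [cb_base s hs, cb_intW_eq s hs]
    simp only [Nat.cast_zero, add_zero, sub_zero]
    rw [Gamma_add_one s s0]
    field_simp
  | succ j ih =>
    have r1 : s + j + 1 ≠ 0 := by
      intro h
      have := congrArg re h
      simp at this
      have : (0 : ℝ) ≤ j := j.cast_nonneg
      linarith
    have r2 : 2 * s + j - 1 ≠ 0 := by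
      intro h
      have := congrArg re h
      simp at this
      have : (0 : ℝ) ≤ j := j.cast_nonneg
      linarith
    apply mul_left_cancel₀ (mul_ne_zero two_ne_zero r1)
    rw [cb_step s hs, ih]
    push_cast
    rw [show s + (j + 1) + 1 = (s + j + 1) + 1 by ring, Gamma_add_one _ r1,
      show 2 * s + (j + 1 : ℂ) - 1 = (2 * s + j - 1) + 1 by ring, Gamma_add_one _ r2,
      show 2 - (j : ℂ) - 2 * s = (2 - (j + 1 : ℂ) - 2 * s) + 1 by ring,
      cpow_add _ _ two_ne_zero, cpow_one, mul_inv]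
    field_simp

/-- For `k ≥ 1` and `Re s ≥ 1`,
`∫ (u-i)/((u+i)^{k+1}(u²+1)^s) du = π 2^{2-k-2s} Γ(2s+k-1)/(Γ(s+k+1)Γ(s-1)) · i^{-(k+2)}`. -/
theorem integral_via_cauchy_beta (k : ℕ) (hk : 1 ≤ k) (s : ℂ) (hs : 1 ≤ s.re) :
    ∫ u : ℝ, ((u : ℂ) - I) / (((u : ℂ) + I) ^ (k + 1) * ((u : ℂ) ^ 2 + 1) ^ s)
      = (Real.pi : ℂ) * (2 : ℂ) ^ (2 - (k : ℂ) - 2 * s) * Complex.Gamma (2 * s + k - 1) /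
          (Complex.Gamma (s + k + 1) * Complex.Gamma (s - 1)) * I ^ (-(k + 2 : ℤ)) := by
  rw [← cb_closed s hs k, mul_comm _ (I ^ _), ← MeasureTheory.integral_const_mul]
  refine MeasureTheory.integral_congr_ae (Filter.Eventually.of_forall fun u => ?_)
  simp only [cbF, cbW]
  have e1 : (u : ℂ) - I = I⁻¹ * (1 + u * I) := by
    rw [inv_I]; linear_combination (u : ℂ) * I_mul_I
  have e2 : (u : ℂ) + I = I * (1 - u * I) := by
    linear_combination (u : ℂ) * I_mul_I
  have hI : I ^ (-(k + 2 : ℤ)) = I⁻¹ * (I ^ (k + 1))⁻¹ := by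
    rw [zpow_neg, ← mul_inv, ← pow_succ', ← zpow_natCast]
    push_cast
    ring_nf
  rw [e1, e2, hI, mul_pow, cpow_neg, div_eq_mul_inv, div_eq_mul_inv, mul_inv, mul_inv]
  ring
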